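/- The following identity relating three convergent alternating series holds: (√3/2) · Σ_{n=0}^{∞} [(1/2)_n^3 / ((1)_n (3/4)_n (5/4)_n)] (10n+3) (−1)^n (3/4)^{2n} − (√2 π² / (8 Γ(3/4)^4)) · Σ_{n=0}^{∞} [(1/4)_n^3 / ((1)_n (1/2)_n (3/4)_n)] (20n+1) (−1)^n (3/4)^{2n} − (3√2 Γ(3/4)^4 / (16 π²)) · Σ_{n=0}^{∞} [(3/4)_n^3 / ((1)_n (3/2)_n (5/4)_n)] (20n+11) (−1)^n (3/4)^{2n} = 1, where Γ(3/4) is the value of the Gamma function at 3/4. -/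

import Mathlib

open Real

/-- Rising factorial `(a)ₙ = a(a+1)⋯(a+n−1)`. -/
noncomputable def pochR (a : ℝ) (n : ℕ) : ℝ := ∏ i ∈ Finset.range n, (a + i)

noncomputable def term1 (n : ℕ) : ℝ :=
  pochR (1/2) n ^ 3 / (pochR 1 n * pochR (3/4) n * pochR (5/4) n) *
    (10*(n : ℝ) + 3) * (-1)^n * ((3/4 : ℝ))^(2*n)

noncomputable def term2 (n : ℕ) : ℝ :=
  pochR (1/4) n ^ 3 / (pochR 1 n * pochR (1/2) n * pochR (3/4) n) *
    (20*(n : ℝ) + 1) * (-1)^n * ((3/4 : ℝ))^(2*n)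

noncomputable def term3 (n : ℕ) : ℝ :=
  pochR (3/4) n ^ 3 / (pochR 1 n * pochR (3/2) n * pochR (5/4) n) *
    (20*(n : ℝ) + 11) * (-1)^n * ((3/4 : ℝ))^(2*n)


open MeasureTheory Set

/-- The basic quantity `e^x + e^{-x} + a`. -/
noncomputable def qq (a x : ℝ) : ℝ := exp x + exp (-x) + a

lemma qq_lb {a : ℝ} (ha : -1 ≤ a) (x : ℝ) : exp |x| / 2 ≤ qq a x := by
  unfold qq
  have h1 : exp x * exp (-x) = 1 := by rw [← exp_add]; simp
  have h2 := exp_pos x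
  have h3 := exp_pos (-x)
  have h4 : 2 ≤ exp x + exp (-x) := by nlinarith [sq_nonneg (exp x - exp (-x))]
  rcases abs_cases x with ⟨h, _⟩ | ⟨h, _⟩ <;> rw [h] <;> nlinarith

lemma qq_pos {a : ℝ} (ha : -1 ≤ a) (x : ℝ) : 0 < qq a x :=
  lt_of_lt_of_le (by positivity) (qq_lb ha x)

lemma qq_cont (a : ℝ) : Continuous (qq a) := by unfold qq; fun_prop

lemma qq_rpow_cont {a : ℝ} (ha : -1 ≤ a) (k : ℝ) : Continuous (fun x => qq a x ^ k) :=
  (qq_cont a).rpow_const (fun x => Or.inl (qq_pos ha x).ne')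

lemma qq_bound {a k : ℝ} (ha : -1 ≤ a) (hk : 0 < k) (x : ℝ) :
    qq a x ^ (-k) ≤ 2 ^ k * exp (-k * |x|) := by
  have h1 : qq a x ^ (-k) ≤ (exp |x| / 2) ^ (-k) :=
    rpow_le_rpow_of_nonpos (by positivity) (qq_lb ha x) (by linarith)
  refine h1.trans (le_of_eq ?_)
  rw [div_rpow (by positivity) (by norm_num), ← exp_mul, rpow_neg (by norm_num : (0:ℝ) ≤ 2)]
  field_simp
  

lemma int_exp_abs {k : ℝ} (hk : 0 < k) : Integrable (fun x : ℝ => exp (-k * |x|)) := by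
  rw [← integrableOn_univ, ← Set.Iic_union_Ioi (a := (0:ℝ))]
  apply IntegrableOn.union
  · refine (integrableOn_exp_mul_Iic hk 0).congr_fun ?_ measurableSet_Iic
    intro x hx
    simp only [mem_Iic] at hx
    simp [abs_of_nonpos hx]
  · refine (integrableOn_exp_mul_Ioi (a := -k) (by linarith) 0).congr_fun ?_ measurableSet_Ioi
    intro x hx
    simp only [mem_Ioi] at hx
    simp [abs_of_pos hx]

lemma qq_int {a k : ℝ} (ha : -1 ≤ a) (hk : 0 < k) : Integrable (fun x => qq a x ^ (-k)) := by
  refine ((int_exp_abs hk).const_mul (2 ^ k)).mono'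
    (qq_rpow_cont ha _).aestronglyMeasurable (Filter.Eventually.of_forall fun x => ?_)
  rw [norm_of_nonneg (rpow_nonneg (qq_pos ha x).le _)]
  exact qq_bound ha hk x

/-- The moment integrals. -/
noncomputable def MM (k a : ℝ) : ℝ := ∫ x, qq a x ^ (-k)

lemma MM_deriv {a k : ℝ} (ha : -1 < a) (hk : 0 < k) :
    HasDerivAt (MM k) (-k * MM (k + 1) a) a := by
  have := (hasDerivAt_integral_of_dominated_loc_of_deriv_le (μ := volume)
    (F := fun a x => qq a x ^ (-k)) (F' := fun a x => -k * qq a x ^ (-(k+1)))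
    (s := Ioi (-1)) (x₀ := a) (bound := fun x => k * (2 ^ (k+1) * exp (-(k+1) * |x|)))
    (Ioi_mem_nhds ha) ?_ (qq_int ha.le hk) ?_ ?_ ?_ ?_).2
  · rw [integral_const_mul] at this
    exact this
  · filter_upwards [Ioi_mem_nhds ha] with b hb
    exact (qq_rpow_cont (le_of_lt hb) _).aestronglyMeasurable
  · exact ((qq_rpow_cont ha.le _).const_mul _).aestronglyMeasurable
  · refine Filter.Eventually.of_forall fun x b hb => ?_
    rw [norm_mul, norm_of_nonneg (rpow_nonneg (qq_pos (le_of_lt hb) x).le _), norm_neg,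
      norm_of_nonneg hk.le]
    exact mul_le_mul_of_nonneg_left (qq_bound (le_of_lt hb) (by linarith) x) hk.le
  · exact ((int_exp_abs (by linarith : 0 < k + 1)).const_mul _).const_mul _
  · refine Filter.Eventually.of_forall fun x b hb => ?_
    have h1 : HasDerivAt (fun a => qq a x) 1 b := by
      unfold qq; simpa using (hasDerivAt_id b).const_add (exp x + exp (-x))
    have := h1.rpow_const (p := -k) (Or.inl (qq_pos (le_of_lt hb) x).ne')
    convert! this using 1
    rw [show -(k+1) = -k - 1 by ring]; ring

lemma qq_deriv (a x : ℝ) : HasDerivAt (qq a) (exp x - exp (-x)) x := by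
  have h := ((hasDerivAt_id x).exp.add ((hasDerivAt_id x).neg.exp)).add_const a
  convert! h using 1
  simp; ring

lemma qq_rpow_deriv {a : ℝ} (ha : -1 ≤ a) (k x : ℝ) :
    HasDerivAt (fun x => qq a x ^ k) ((exp x - exp (-x)) * k * qq a x ^ (k-1)) x :=
  (qq_deriv a x).rpow_const (Or.inl (qq_pos ha x).ne')

/-- The Legendre differential equation, in moment form. -/
lemma MM_ode {a : ℝ} (ha : -1 ≤ a) :
    (3/4) * (4 - a^2) * MM (5/2) a + a * MM (3/2) a - (1/4) * MM (1/2) a = 0 := by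
  have hi1 := qq_int ha (by norm_num : (0:ℝ) < 1/2)
  have hi3 := qq_int ha (by norm_num : (0:ℝ) < 3/2)
  have hi5 := qq_int ha (by norm_num : (0:ℝ) < 5/2)
  have key := integral_eq_zero_of_hasDerivAt_of_integrable
    (f := fun x => (exp x - exp (-x)) / 2 * qq a x ^ (-(3/2) : ℝ))
    (f' := fun x => (3/4) * (4 - a^2) * qq a x ^ (-(5/2) : ℝ) + a * qq a x ^ (-(3/2) : ℝ)
      - (1/4) * qq a x ^ (-(1/2) : ℝ)) ?_ ?_ ?_
  · rw [integral_sub (by exact (hi5.const_mul _).add (hi3.const_mul _)) (hi1.const_mul _),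
      integral_add (hi5.const_mul _) (hi3.const_mul _), integral_const_mul, integral_const_mul,
      integral_const_mul] at key
    exact key
  · intro x
    have h1 : HasDerivAt (fun x : ℝ => (exp x - exp (-x)) / 2) ((exp x + exp (-x)) / 2) x := by
      have h := ((hasDerivAt_id x).exp.sub ((hasDerivAt_id x).neg.exp)).div_const 2
      convert! h using 1
      simp
    convert! h1.mul (qq_rpow_deriv ha (-(3/2)) x) using 1
    have hq := qq_pos ha x
    have e1 : qq a x ^ (-(3/2) : ℝ) = qq a x ^ (-(5/2) : ℝ) * qq a x := by
      rw [← rpow_add_one hq.ne']; norm_num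
    have e2 : qq a x ^ (-(1/2) : ℝ) = qq a x ^ (-(5/2) : ℝ) * qq a x * qq a x := by
      rw [← rpow_add_one hq.ne', ← rpow_add_one hq.ne']; norm_num
    rw [show (-(3/2) - 1 : ℝ) = -(5/2) by norm_num, e1, e2]
    have hE : exp x * exp (-x) = 1 := by rw [← exp_add]; simp
    generalize qq a x ^ (-(5/2) : ℝ) = R
    unfold qq
    linear_combination (-3) * R * hE
  · exact ((hi5.const_mul _).add (hi3.const_mul _)).sub (hi1.const_mul _)
  · refine (hi1.const_mul 2).mono' ?_ (Filter.Eventually.of_forall fun x => ?_)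
    · exact ((by fun_prop : Continuous fun x : ℝ => (exp x - exp (-x)) / 2).mul
        (qq_rpow_cont ha _)).aestronglyMeasurable
    · have hq := qq_pos ha x
      have e2 : qq a x ^ (-(1/2) : ℝ) = qq a x ^ (-(3/2) : ℝ) * qq a x := by
        rw [← rpow_add_one hq.ne']; norm_num
      have hr : 0 ≤ qq a x ^ (-(3/2) : ℝ) := rpow_nonneg hq.le _
      have hb := qq_lb ha x
      rw [norm_mul, norm_of_nonneg hr, e2, mul_comm, mul_left_comm]
      refine mul_le_mul_of_nonneg_left ?_ hr
      have h2 : exp x ≤ exp |x| := exp_le_exp.2 (le_abs_self x)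
      have h3 : exp (-x) ≤ exp |x| := exp_le_exp.2 (neg_le_abs x)
      have := exp_pos x
      have := exp_pos (-x)
      rw [norm_eq_abs, abs_le]
      constructor <;> linarith

lemma beta_int {p r : ℝ} (hp : 0 < p) (hr : 0 < r) :
    ∫ x in Ioo (0:ℝ) 1, x ^ (p-1) * (1-x) ^ (r-1) = Gamma p * Gamma r / Gamma (p + r) := by
  have h := ProbabilityTheory.beta_eq_betaIntegralReal p r hp hr
  unfold ProbabilityTheory.beta at h
  rw [h, Complex.betaIntegral, intervalIntegral.integral_of_le zero_le_one,
    integral_Ioc_eq_integral_Ioo]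
  rw [← Complex.ofReal_re (∫ x in Ioo (0:ℝ) 1, x ^ (p-1) * (1-x) ^ (r-1)), ← integral_complex_ofReal]
  congr 1
  refine setIntegral_congr_fun measurableSet_Ioo fun x hx => ?_
  simp only [mem_Ioo] at hx
  push_cast
  rw [Complex.ofReal_cpow hx.1.le, Complex.ofReal_cpow (by linarith)]
  push_cast
  rfl

lemma MM_zero {c : ℝ} (hc : 0 < c) : 2 * MM (2 * c) 0 = Gamma c * Gamma c / Gamma (c + c) := by
  rw [← beta_int hc hc]
  set f : ℝ → ℝ := fun x => 1 / (1 + exp (-2 * x)) with hf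
  have hd : ∀ x, HasDerivAt f (2 * (f x * (1 - f x))) x := by
    intro x
    have h1 : HasDerivAt (fun x : ℝ => 1 + exp (-2 * x)) (exp (-2 * x) * (-2)) x := by
      have := ((hasDerivAt_id x).const_mul (-2)).exp.const_add 1
      convert! this using 1
      simp
    have h2 : (1 + exp (-2 * x)) ≠ 0 := by positivity
    convert! (hasDerivAt_const x (1:ℝ)).div h1 h2 using 1
    simp only [hf]
    field_simp
    ring
  have hfpos : ∀ x, 0 < f x := fun x => by simp only [hf]; positivity
  have hflt : ∀ x, 0 < 1 - f x := fun x => by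
    simp only [hf]
    have : 0 < exp (-2 * x) := exp_pos _
    rw [sub_pos, div_lt_one (by positivity)]; linarith
  have hprod : ∀ x, f x * (1 - f x) = qq 0 x ^ (-2 : ℝ) := by
    intro x
    rw [rpow_neg (qq_pos (by norm_num) x).le]
    rw [show (2:ℝ) = ((2:ℕ):ℝ) by norm_num, rpow_natCast]
    simp only [hf, qq]
    have e1 : exp (-2 * x) = (exp x)⁻¹ * (exp x)⁻¹ := by
      rw [← exp_neg, ← exp_add]; ring_nf
    rw [exp_neg]
    push_cast
    rw [e1]
    have := exp_pos x
    field_simp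
    ring
  have hinj : InjOn f univ := by
    have : StrictMono f := strictMono_of_deriv_pos fun x => by
      rw [(hd x).deriv]; exact mul_pos two_pos (mul_pos (hfpos x) (hflt x))
    exact this.injective.injOn
  have himg : f '' univ = Ioo 0 1 := by
    ext y
    simp only [image_univ, mem_range, mem_Ioo]
    constructor
    · rintro ⟨x, rfl⟩
      exact ⟨hfpos x, by linarith [hflt x]⟩
    · rintro ⟨h0, h1⟩
      refine ⟨-(log ((1-y)/y))/2, ?_⟩
      have : 0 < (1 - y)/y := div_pos (by linarith) h0
      simp only [hf]
      rw [show -2 * (-(log ((1-y)/y))/2) = log ((1-y)/y) by ring, exp_log this]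
      field_simp
      ring
  have key := integral_image_eq_integral_abs_deriv_smul MeasurableSet.univ
    (fun x _ => (hd x).hasDerivWithinAt) hinj (fun x => x ^ (c-1) * (1-x) ^ (c-1))
  rw [himg, setIntegral_univ] at key
  rw [key, MM, ← integral_const_mul]
  congr 1
  ext x
  have hp := mul_pos (hfpos x) (hflt x)
  rw [smul_eq_mul, abs_of_pos (mul_pos two_pos hp), ← mul_rpow (hfpos x).le (hflt x).le, mul_assoc,
    mul_comm (f x * (1 - f x)), ← rpow_add_one hp.ne', hprod, ← rpow_mul (qq_pos (by norm_num) x).le]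
  ring_nf

/-- Auxiliary variable `t = √3 e^x + 1`. -/
noncomputable def tt (x : ℝ) : ℝ := √3 * exp x + 1

lemma tt_gt (x : ℝ) : 1 < tt x := by
  unfold tt
  have : 0 < √3 * exp x := by positivity
  linarith

lemma sq3 : √3 * √3 = 3 := mul_self_sqrt (by norm_num)

lemma tt_deriv (x : ℝ) : HasDerivAt tt (tt x - 1) x := by
  unfold tt
  convert! ((hasDerivAt_id x).exp.const_mul (√3)).add_const 1 using 1
  simp

lemma tt_qq (x : ℝ) : √3 * (tt x - 1) * qq (√3) x = tt x ^ 2 + tt x + 1 := by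
  have hE : exp x * exp (-x) = 1 := by rw [← exp_add]; simp
  unfold tt qq
  linear_combination (√3 * √3) * hE + (exp x * √3 + 1) * sq3

lemma MM_sqrt3 {p : ℝ} (hp : 0 < p) :
    Gamma p * Gamma (1/2) / Gamma (p + 1/2) =
      3 ^ (3/4 : ℝ) * ∫ x, tt x ^ (1/2 - 3 * p) * qq (√3) x ^ (-(1/2) : ℝ) := by
  rw [← beta_int hp (by norm_num)]
  have ha : (-1 : ℝ) ≤ √3 := by linarith [sqrt_nonneg 3]
  set f : ℝ → ℝ := fun x => (tt x ^ 3)⁻¹ with hf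
  have ht0 : ∀ x, 0 < tt x := fun x => by linarith [tt_gt x]
  have hd : ∀ x, HasDerivAt f (-(3 * (tt x - 1) / tt x ^ 4)) x := by
    intro x
    have h := ((tt_deriv x).pow 3).inv (pow_pos (ht0 x) 3).ne'
    convert! h using 1
    have := ht0 x
    simp
    field_simp
  have hfpos : ∀ x, 0 < f x := fun x => inv_pos.2 (pow_pos (ht0 x) 3)
  have hflt : ∀ x, f x < 1 := fun x => inv_lt_one_of_one_lt₀ (one_lt_pow₀ (tt_gt x) (by norm_num))
  have hinj : InjOn f univ := by
    have : StrictAnti f := strictAnti_of_deriv_neg fun x => by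
      rw [(hd x).deriv]
      have := tt_gt x
      have := ht0 x
      have : 0 < 3 * (tt x - 1) / tt x ^ 4 := div_pos (by linarith) (by positivity)
      linarith
    exact this.injective.injOn
  have himg : f '' univ = Ioo 0 1 := by
    ext y
    simp only [image_univ, mem_range, mem_Ioo]
    constructor
    · rintro ⟨x, rfl⟩
      exact ⟨hfpos x, hflt x⟩
    · rintro ⟨h0, h1⟩
      set z := y ^ (-(1/3) : ℝ) with hz
      have hz1 : 1 < z := one_lt_rpow_of_pos_of_lt_one_of_neg h0 h1 (by norm_num)
      have hz3 : z ^ 3 = y⁻¹ := by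
        rw [hz, ← rpow_natCast, ← rpow_mul h0.le, ← rpow_neg_one]; norm_num
      refine ⟨log ((z - 1) / √3), ?_⟩
      have : 0 < (z - 1) / √3 := div_pos (by linarith) (by positivity)
      simp only [hf, tt]
      rw [exp_log this, mul_div_cancel₀ _ (by positivity), sub_add_cancel, hz3, inv_inv]
  have key := integral_image_eq_integral_abs_deriv_smul MeasurableSet.univ
    (fun x _ => (hd x).hasDerivWithinAt) hinj (fun x => x ^ (p-1) * (1-x) ^ ((1/2:ℝ)-1))
  rw [himg, setIntegral_univ] at key
  rw [key, ← integral_const_mul]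
  congr 1
  ext x
  have h1 := tt_gt x
  have h0 := ht0 x
  have hq := qq_pos ha x
  have hm : 0 < tt x - 1 := by linarith
  have e1 : 1 - f x = √3 * (tt x - 1) ^ 2 * qq (√3) x * (tt x) ^ (-3 : ℝ) := by
    have := tt_qq x
    rw [rpow_neg h0.le, show (3:ℝ) = ((3:ℕ):ℝ) by norm_num, rpow_natCast]
    simp only [hf]
    push_cast
    field_simp
    linear_combination (-(tt x - 1)) * this
  have e2 : f x = tt x ^ (-3 : ℝ) := by
    rw [rpow_neg h0.le, show (3:ℝ) = ((3:ℕ):ℝ) by norm_num, rpow_natCast]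
  have e3 : 3 * (tt x - 1) / tt x ^ 4 = 3 * (tt x - 1) * tt x ^ (-4 : ℝ) := by
    rw [rpow_neg h0.le, show (4:ℝ) = ((4:ℕ):ℝ) by norm_num, rpow_natCast]; rfl
  have e4 : ((tt x - 1) ^ 2) ^ ((1/2 : ℝ) - 1) = (tt x - 1)⁻¹ := by
    rw [← rpow_natCast, ← rpow_mul hm.le, ← rpow_neg_one]; norm_num
  have e5 : √3 ^ ((1/2 : ℝ) - 1) = 3 ^ (-(1/4) : ℝ) := by
    rw [sqrt_eq_rpow, ← rpow_mul (by norm_num)]; norm_num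
  have e6 : (3:ℝ) ^ (3/4 : ℝ) = 3 ^ (-(1/4) : ℝ) * 3 := by
    rw [← rpow_add_one (by norm_num)]; norm_num
  have e7 : tt x ^ (1/2 - 3 * p) = tt x ^ (-3 * (p-1)) * tt x ^ (-3 * ((1/2 : ℝ) - 1)) * tt x ^ (-4 : ℝ) := by
    rw [← rpow_add h0, ← rpow_add h0]; ring_nf
  rw [smul_eq_mul, abs_neg, e3, abs_of_pos (by positivity), e1, e2, mul_rpow (by positivity) (by positivity),
    mul_rpow (by positivity) hq.le, mul_rpow (by positivity) (by positivity), ← rpow_mul h0.le,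
    ← rpow_mul h0.le, e4, e5, e6, e7, show ((1/2:ℝ) - 1) = -(1/2) by norm_num]
  field_simp

lemma int_tt {k : ℝ} (hk : k ≤ 0) :
    Integrable (fun x => tt x ^ k * qq (√3) x ^ (-(1/2) : ℝ)) := by
  have ha : (-1 : ℝ) ≤ √3 := by linarith [sqrt_nonneg 3]
  refine (qq_int ha (by norm_num : (0:ℝ) < 1/2)).mono' ?_ (Filter.Eventually.of_forall fun x => ?_)
  · refine Continuous.aestronglyMeasurable (Continuous.mul ?_ (qq_rpow_cont ha _))
    refine Continuous.rpow_const (by unfold tt; fun_prop) (fun x => Or.inl ?_)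
    linarith [tt_gt x]
  · have h1 := rpow_nonneg (qq_pos ha x).le (-(1/2))
    have h2 := rpow_nonneg (by linarith [tt_gt x] : 0 ≤ tt x) k
    have h3 := rpow_le_one_of_one_le_of_nonpos (tt_gt x).le hk
    rw [norm_of_nonneg (mul_nonneg h2 h1)]
    nlinarith

lemma MM_rel : MM (1/2) (√3) + √3 * MM (3/2) (√3) =
    4 * ∫ x, tt x ^ (-2 : ℝ) * qq (√3) x ^ (-(1/2) : ℝ) := by
  have ha : (-1 : ℝ) ≤ √3 := by linarith [sqrt_nonneg 3]
  have hi1 := qq_int ha (by norm_num : (0:ℝ) < 1/2)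
  have hi3 := qq_int ha (by norm_num : (0:ℝ) < 3/2)
  have hi2 := int_tt (k := -2) (by norm_num)
  have hi0 := int_tt (k := -1) (by norm_num)
  have key := integral_eq_zero_of_hasDerivAt_of_integrable
    (f := fun x => 2 * qq (√3) x ^ (-(1/2) : ℝ) + 4 * (tt x ^ (-1 : ℝ) * qq (√3) x ^ (-(1/2) : ℝ)))
    (f' := fun x => 4 * (tt x ^ (-2 : ℝ) * qq (√3) x ^ (-(1/2) : ℝ)) - (qq (√3) x ^ (-(1/2) : ℝ)
      + √3 * qq (√3) x ^ (-(3/2) : ℝ))) ?_ ?_ ?_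
  · rw [integral_sub (hi2.const_mul _) (by exact hi1.add (hi3.const_mul _)),
      integral_add hi1 (hi3.const_mul _), integral_const_mul, integral_const_mul] at key
    unfold MM
    linarith
  · intro x
    have h0 : 0 < tt x := by linarith [tt_gt x]
    have h1 := qq_rpow_deriv ha (-(1/2)) x
    have h2 := (tt_deriv x).rpow_const (p := -1) (Or.inl h0.ne')
    convert! (h1.const_mul 2).add ((h2.mul h1).const_mul 4) using 1
    have hq := qq_pos ha x
    have e1 : qq (√3) x ^ (-(1/2) : ℝ) = qq (√3) x ^ (-(3/2) : ℝ) * qq (√3) x := by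
      rw [← rpow_add_one hq.ne']; norm_num
    rw [show (-(1/2) - 1 : ℝ) = -(3/2) by norm_num, e1]
    have e2 : tt x ^ (-2 : ℝ) = (tt x ^ 2)⁻¹ := by
      rw [rpow_neg h0.le, show (2:ℝ) = ((2:ℕ):ℝ) by norm_num, rpow_natCast]
    rw [rpow_neg_one, show (-1 - 1 : ℝ) = -2 by norm_num, e2]
    generalize qq (√3) x ^ (-(3/2) : ℝ) = R
    have hE : exp (-x) = (exp x)⁻¹ := exp_neg x
    unfold tt at *
    unfold qq
    rw [hE]
    have hp := exp_pos x
    generalize exp x = E at *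
    have h3 := sq3
    generalize √3 = s at *
    field_simp
    linear_combination R * (-4 * s * E ^ 3 - 4 * E ^ 2) * h3
  · exact (hi2.const_mul _).sub (hi1.add (hi3.const_mul _))
  · exact (hi1.const_mul _).add (hi0.const_mul _)

lemma final_val : MM (1/2) (√3) * (MM (1/2) (√3) + √3 * MM (3/2) (√3)) = 4 * π := by
  rw [MM_rel]
  have h1 := MM_sqrt3 (p := 1/6) (by norm_num)
  have h5 := MM_sqrt3 (p := 5/6) (by norm_num)
  norm_num at h1 h5
  have hM : MM (1/2) (√3) = ∫ x, qq (√3) x ^ (-(1/2) : ℝ) := rfl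
  rw [hM]
  norm_num
  have g1 := Real.Gamma_mul_Gamma_one_sub (1/6)
  have g2 := Real.Gamma_mul_Gamma_one_sub (1/3)
  have g3 := Real.Gamma_add_one (s := 1/3) (by norm_num)
  have g4 := Real.Gamma_one_half_eq
  rw [show π * (1/6) = π / 6 by ring, sin_pi_div_six] at g1
  rw [show π * (1/3) = π / 3 by ring, sin_pi_div_three] at g2
  norm_num at g1 g2 g3 g4
  rw [g4] at h1 h5
  rw [g3] at h5
  have p1 : 0 < Gamma (1/3) := Gamma_pos_of_pos (by norm_num)
  have p2 : 0 < Gamma (2/3) := Gamma_pos_of_pos (by norm_num)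
  have hk : (3:ℝ) ^ (3/4 : ℝ) * 3 ^ (3/4 : ℝ) = 3 * √3 := by
    rw [← rpow_add (by norm_num), sqrt_eq_rpow, mul_comm (3:ℝ), ← rpow_add_one (by norm_num)]
    norm_num
  have hpi : √π * √π = π := mul_self_sqrt pi_pos.le
  have hs := sq3
  have hs0 : 0 < √3 := by positivity
  generalize (∫ x : ℝ, qq (√3) x ^ (-(1/2) : ℝ)) = X at *
  generalize (∫ x : ℝ, (tt x ^ 2)⁻¹ * qq (√3) x ^ (-(1/2) : ℝ)) = Y at *
  rw [div_eq_iff p2.ne'] at h1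
  rw [div_eq_iff (by positivity)] at h5
  have e1 : (Gamma (1/6) * Gamma (5/6)) * (√π * √π) =
      (3 ^ (3/4 : ℝ) * 3 ^ (3/4 : ℝ)) * X * Y * ((1/3) * (Gamma (1/3) * Gamma (2/3))) := by
    linear_combination Gamma (5/6) * √π * h1 + 3 ^ (3/4 : ℝ) * X * Gamma (2/3) * h5
  rw [g1, g2, hk, hpi] at e1
  field_simp at e1
  linarith

/-- Sum of a power series. -/
noncomputable def ps (e : ℕ → ℝ) (s : ℝ) : ℝ := ∑' m, e m * s ^ m

/-- Polynomially bounded coefficients. -/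
def PB (e : ℕ → ℝ) : Prop := ∃ C : ℝ, ∃ k : ℕ, 0 ≤ C ∧ ∀ m : ℕ, |e m| ≤ C * ((m:ℝ) + 1) ^ k

/-- Coefficients of the derivative. -/
def dd (e : ℕ → ℝ) (m : ℕ) : ℝ := ((m:ℝ) + 1) * e (m + 1)

lemma geo_sum (k : ℕ) {ρ : ℝ} (h0 : 0 < ρ) (h1 : ρ < 1) :
    Summable (fun m : ℕ => ((m:ℝ) + 1) ^ k * ρ ^ m) := by
  have h := summable_pow_mul_geometric_of_norm_lt_one (R := ℝ) k (r := ρ)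
    (by rwa [norm_of_nonneg h0.le])
  have h2 := ((summable_nat_add_iff 1).2 h).mul_right ρ⁻¹
  refine h2.congr fun m => ?_
  push_cast
  rw [pow_succ]
  field_simp

lemma ps_summable {e : ℕ → ℝ} (he : PB e) {s : ℝ} (hs : |s| < 1) :
    Summable (fun m => e m * s ^ m) := by
  obtain ⟨C, k, hC, he⟩ := he
  have h0 := abs_nonneg s
  have hg := (geo_sum k (ρ := (|s| + 1) / 2) (by linarith) (by linarith)).mul_left C
  refine Summable.of_norm_bounded hg fun m => ?_
  rw [norm_mul, norm_pow, norm_eq_abs, norm_eq_abs, ← mul_assoc]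
  refine mul_le_mul (he m) (pow_le_pow_left₀ h0 (by linarith) m) (by positivity) (by positivity)

lemma PB_mul {e : ℕ → ℝ} (he : PB e) : PB (fun m => ((m:ℝ) + 1) * e m) := by
  obtain ⟨C, k, hC, he⟩ := he
  refine ⟨C, k + 1, hC, fun m => ?_⟩
  rw [abs_mul, abs_of_pos (by positivity : (0:ℝ) < (m:ℝ) + 1), pow_succ]
  nlinarith [he m, (by positivity : (0:ℝ) < (m:ℝ) + 1)]

lemma PB_dd {e : ℕ → ℝ} (he : PB e) : PB (dd e) := by
  obtain ⟨C, k, hC, he⟩ := he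
  refine ⟨C * 2 ^ k, k + 1, by positivity, fun m => ?_⟩
  have hm : (0:ℝ) < (m:ℝ) + 1 := by positivity
  rw [dd, abs_mul, abs_of_pos hm, pow_succ]
  have h1 := he (m + 1)
  push_cast at h1
  have h2 : ((m:ℝ) + 1 + 1) ^ k ≤ (2 * ((m:ℝ) + 1)) ^ k :=
    pow_le_pow_left₀ (by positivity) (by linarith) k
  rw [mul_pow] at h2
  have h3 : |e (m+1)| ≤ C * (2 ^ k * ((m:ℝ) + 1) ^ k) :=
    h1.trans (mul_le_mul_of_nonneg_left h2 hC)
  nlinarith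

lemma ps_deriv {e : ℕ → ℝ} (he : PB e) {s : ℝ} (hs : |s| < 1) :
    HasDerivAt (ps e) (ps (dd e) s) s := by
  have he' := he
  obtain ⟨C, k, hC, hb⟩ := PB_dd he
  have h0 := abs_nonneg s
  set ρ := (|s| + 1) / 2 with hρ
  have hρ0 : 0 < ρ := by rw [hρ]; linarith
  have hρ1 : ρ < 1 := by rw [hρ]; linarith
  have hsρ : |s| < ρ := by rw [hρ]; linarith
  have hu : Summable (fun m : ℕ => |e m| * ((m:ℝ) * ρ ^ (m - 1))) := by
    rw [← summable_nat_add_iff 1]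
    refine Summable.of_nonneg_of_le (fun m => by positivity) (fun m => ?_)
      ((geo_sum k hρ0 hρ1).mul_left C)
    have h1 := hb m
    rw [dd, abs_mul, abs_of_pos (by positivity : (0:ℝ) < (m:ℝ) + 1)] at h1
    simp only [Nat.add_sub_cancel]
    push_cast
    have : 0 < ρ ^ m := by positivity
    nlinarith
  have key := hasDerivAt_tsum_of_isPreconnected (g := fun m y => e m * y ^ m)
    (g' := fun m y => e m * ((m:ℝ) * y ^ (m - 1))) (t := Metric.ball (0:ℝ) ρ) (y₀ := 0) (y := s)
    hu Metric.isOpen_ball (convex_ball (0:ℝ) ρ).isPreconnected ?_ ?_ ?_ ?_ ?_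
  · convert! key using 1
    have hsum : Summable (fun m : ℕ => e m * ((m:ℝ) * s ^ (m - 1))) := by
      refine Summable.of_norm_bounded hu fun m => ?_
      rw [norm_mul, norm_mul, norm_pow, norm_eq_abs, norm_eq_abs, norm_eq_abs, Nat.abs_cast]
      gcongr
    rw [hsum.tsum_eq_zero_add]
    simp only [ps, dd]
    simp
    congr 1
    ext m
    ring
  · intro m y _
    exact (hasDerivAt_pow m y).const_mul (e m)
  · intro m y hy
    rw [mem_ball_zero_iff, norm_eq_abs] at hy
    rw [norm_mul, norm_mul, norm_pow, norm_eq_abs, norm_eq_abs, norm_eq_abs, Nat.abs_cast]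
    gcongr
  · simpa using hρ0
  · exact ps_summable he' (by simp)
  · simpa using hsρ

lemma ps_shift {f : ℕ → ℝ} {s : ℝ} (hf : Summable (fun m => f m * s ^ m)) (h0 : f 0 = 0) :
    s * ps (fun m => f (m + 1)) s = ps f s := by
  unfold ps
  rw [hf.tsum_eq_zero_add, h0, ← tsum_mul_left]
  simp only [pow_zero, zero_mul, zero_add]
  congr 1
  ext m
  ring

/-- Coefficients of the three-term hypergeometric solution. -/
noncomputable def ee (c0 c1 c2 : ℝ) : ℕ → ℝ
  | 0 => c0
  | 1 => c1
  | 2 => c2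
  | 3 => 0
  | (m + 4) => -(((m:ℝ) + 1) ^ 3 / (((m:ℝ) + 4) * ((m:ℝ) + 3) * ((m:ℝ) + 2))) * ee c0 c1 c2 m

lemma ee_succ (c0 c1 c2 : ℝ) (m : ℕ) : ee c0 c1 c2 (m + 4) =
    -(((m:ℝ) + 1) ^ 3 / (((m:ℝ) + 4) * ((m:ℝ) + 3) * ((m:ℝ) + 2))) * ee c0 c1 c2 m := by
  rw [ee]

lemma ee_bound (c0 c1 c2 : ℝ) (m : ℕ) : |ee c0 c1 c2 m| ≤ |c0| + |c1| + |c2| := by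
  have h0 := abs_nonneg c0
  have h1 := abs_nonneg c1
  have h2 := abs_nonneg c2
  induction m using Nat.strong_induction_on with
  | _ m ih =>
    match m with
    | 0 => simp only [ee]; linarith
    | 1 => simp only [ee]; linarith
    | 2 => simp only [ee]; linarith
    | 3 => simp only [ee, abs_zero]; linarith
    | (m + 4) =>
      rw [ee_succ, abs_mul, abs_neg, abs_of_nonneg (by positivity)]
      have hle : ((m:ℝ) + 1) ^ 3 / (((m:ℝ) + 4) * ((m:ℝ) + 3) * ((m:ℝ) + 2)) ≤ 1 := by
        rw [div_le_one (by positivity)]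
        have : (0:ℝ) ≤ m := Nat.cast_nonneg m
        nlinarith [mul_nonneg this this]
      calc _ ≤ 1 * |ee c0 c1 c2 m| := mul_le_mul_of_nonneg_right hle (abs_nonneg _)
        _ ≤ _ := by rw [one_mul]; exact ih m (by omega)

lemma ee_PB (c0 c1 c2 : ℝ) : PB (ee c0 c1 c2) :=
  ⟨|c0| + |c1| + |c2|, 0, by positivity, fun m => by simpa using ee_bound c0 c1 c2 m⟩

lemma PB_of_le {e f : ℕ → ℝ} (he : PB e) (h : ∀ m, |f m| ≤ |e m|) : PB f := by
  obtain ⟨C, k, hC, he⟩ := he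
  exact ⟨C, k, hC, fun m => (h m).trans (he m)⟩

lemma theta1 {e : ℕ → ℝ} (he : PB e) {s : ℝ} (hs : |s| < 1) :
    s * ps (dd e) s = ps (fun m => (m:ℝ) * e m) s := by
  have h := ps_shift (f := fun m => (m:ℝ) * e m) (s := s) ?_ (by simp)
  · rw [← h]
    congr 2
    ext m
    simp [dd]
  · apply ps_summable _ hs
    refine PB_of_le (PB_mul he) fun m => ?_
    rw [abs_mul, abs_mul, Nat.abs_cast, abs_of_pos (by positivity : (0:ℝ) < (m:ℝ) + 1)]
    exact mul_le_mul_of_nonneg_right (by linarith) (abs_nonneg _)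

lemma PB_theta {e : ℕ → ℝ} (he : PB e) : PB (fun m => (m:ℝ) * e m) := by
  refine PB_of_le (PB_mul he) fun m => ?_
  rw [abs_mul, abs_mul, Nat.abs_cast, abs_of_pos (by positivity : (0:ℝ) < (m:ℝ) + 1)]
  exact mul_le_mul_of_nonneg_right (by linarith) (abs_nonneg _)

lemma PB_sub {e f : ℕ → ℝ} (he : PB e) (hf : PB f) : PB (fun m => e m - f m) := by
  obtain ⟨C, k, hC, he⟩ := he
  obtain ⟨D, l, hD, hf⟩ := hf
  refine ⟨C + D, k + l, by positivity, fun m => ?_⟩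
  have h1 : (1:ℝ) ≤ (m:ℝ) + 1 := by have : (0:ℝ) ≤ m := Nat.cast_nonneg m
                                    linarith
  have h2 : ((m:ℝ)+1) ^ k ≤ ((m:ℝ)+1) ^ (k + l) := pow_le_pow_right₀ h1 (by omega)
  have h3 : ((m:ℝ)+1) ^ l ≤ ((m:ℝ)+1) ^ (k + l) := pow_le_pow_right₀ h1 (by omega)
  have := abs_sub (e m) (f m)
  nlinarith [he m, hf m, mul_le_mul_of_nonneg_left h2 hC, mul_le_mul_of_nonneg_left h3 hD]

lemma theta2 {e : ℕ → ℝ} (he : PB e) {s : ℝ} (hs : |s| < 1) :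
    s * (s * ps (dd (dd e)) s) = ps (fun m => (m:ℝ) * ((m:ℝ) * e m) - (m:ℝ) * e m) s := by
  rw [theta1 (PB_dd he) hs]
  rw [← ps_shift (f := fun m => (m:ℝ) * ((m:ℝ) * e m) - (m:ℝ) * e m) (s := s) _ (by simp)]
  · congr 2
    ext m
    simp only [dd]
    push_cast
    ring
  · exact ps_summable (PB_sub (PB_theta (PB_theta he)) (PB_theta he)) hs

lemma theta3 {e : ℕ → ℝ} (he : PB e) {s : ℝ} (hs : |s| < 1) :
    s * (s * (s * ps (dd (dd (dd e))) s)) =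
      ps (fun m => (m:ℝ) * ((m:ℝ) * ((m:ℝ) * e m) - (m:ℝ) * e m)
        - 2 * ((m:ℝ) * ((m:ℝ) * e m) - (m:ℝ) * e m)) s := by
  have h2 := PB_sub (PB_theta (PB_theta he)) (PB_theta he)
  rw [theta2 (PB_dd he) hs]
  rw [← ps_shift (f := fun m => (m:ℝ) * ((m:ℝ) * ((m:ℝ) * e m) - (m:ℝ) * e m)
        - 2 * ((m:ℝ) * ((m:ℝ) * e m) - (m:ℝ) * e m)) (s := s) _ (by simp)]
  · congr 2
    ext m
    simp only [dd]
    push_cast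
    ring
  · have := (ps_summable (PB_theta h2) hs).sub ((ps_summable h2 hs).mul_left 2)
    refine this.congr fun m => ?_
    ring

lemma ee_ode (c0 c1 c2 : ℝ) {s : ℝ} (hs : |s| < 1) :
    (1 + s ^ 4) * ps (dd (dd (dd (ee c0 c1 c2)))) s =
      -(6 * s ^ 3 * ps (dd (dd (ee c0 c1 c2))) s + 7 * s ^ 2 * ps (dd (ee c0 c1 c2)) s
        + s * ps (ee c0 c1 c2) s) := by
  set e := ee c0 c1 c2 with hee
  have he : PB e := ee_PB c0 c1 c2
  have h2 := PB_sub (PB_theta (PB_theta he)) (PB_theta he)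
  have t1 := theta1 he hs
  have t2 := theta2 he hs
  have t3 := theta3 he hs
  have s3 : Summable (fun m => dd (dd (dd e)) m * s ^ m) :=
    ps_summable (PB_dd (PB_dd (PB_dd he))) hs
  have hsh := ps_shift s3 (by simp [dd, hee, ee])
  have hT : ps (fun m => dd (dd (dd e)) (m + 1)) s = - ps (fun m => ((m:ℝ)+1) ^ 3 * e m) s := by
    unfold ps
    rw [← tsum_neg]
    congr 1
    ext m
    simp only [dd, hee]
    rw [show m + 1 + 1 + 1 + 1 = m + 4 by rfl, ee_succ]
    push_cast
    field_simp
    ring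
  have q0 := ps_summable he hs
  have q1 := ps_summable (PB_theta he) hs
  have q2 := ps_summable h2 hs
  have q3 := (ps_summable (PB_theta h2) hs).sub ((ps_summable h2 hs).mul_left 2)
  have hsum := ((q3.hasSum.add (q2.hasSum.mul_left 6)).add (q1.hasSum.mul_left 7)).add q0.hasSum
  have hT2 : ps (fun m => ((m:ℝ)+1) ^ 3 * e m) s =
      s * (s * (s * ps (dd (dd (dd e))) s)) + 6 * (s * (s * ps (dd (dd e)) s))
        + 7 * (s * ps (dd e) s) + ps e s := by
    rw [t1, t2, t3]
    unfold ps
    rw [show (fun m : ℕ => ((m:ℝ) * ((m:ℝ) * ((m:ℝ) * e m) - (m:ℝ) * e m)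
        - 2 * ((m:ℝ) * ((m:ℝ) * e m) - (m:ℝ) * e m)) * s ^ m) = fun m : ℕ =>
        (m:ℝ) * ((m:ℝ) * ((m:ℝ) * e m) - (m:ℝ) * e m) * s ^ m
        - 2 * (((m:ℝ) * ((m:ℝ) * e m) - (m:ℝ) * e m) * s ^ m) by ext m; ring, ← hsum.tsum_eq]
    congr 1
    ext m
    ring
  rw [hT, hT2] at hsh
  linear_combination -hsh

/-- The algebraic factor `(4 - a^2)^(-1/4)`. -/
noncomputable def rr (a : ℝ) : ℝ := (4 - a ^ 2) ^ (-(1/4) : ℝ)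

lemma rr_pos {a : ℝ} (ha : 0 < 4 - a ^ 2) : 0 < rr a := rpow_pos_of_pos ha _

lemma rr_four {a : ℝ} (ha : 0 < 4 - a ^ 2) : rr a ^ 4 * (4 - a ^ 2) = 1 := by
  unfold rr
  rw [← rpow_natCast, ← rpow_mul ha.le]
  norm_num
  rw [rpow_neg_one]
  field_simp

lemma rr_deriv {a : ℝ} (ha : 0 < 4 - a ^ 2) :
    HasDerivAt rr (a / (2 * (4 - a ^ 2)) * rr a) a := by
  have h1 : HasDerivAt (fun a : ℝ => 4 - a ^ 2) (-(2 * a)) a := by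
    simpa using (hasDerivAt_pow 2 a).const_sub 4
  have h := h1.rpow_const (p := -(1/4)) (Or.inl ha.ne')
  convert! h using 1
  unfold rr
  rw [rpow_sub_one ha.ne']
  field_simp
  ring

/-- The variable `s` as a function of `a`. -/
noncomputable def ss (a : ℝ) : ℝ := a * rr a / 2

lemma ss_deriv {a : ℝ} (ha : 0 < 4 - a ^ 2) :
    HasDerivAt ss (rr a * (8 - a ^ 2) / (4 * (4 - a ^ 2))) a := by
  have h := ((hasDerivAt_id a).mul (rr_deriv ha)).div_const 2
  convert! h using 1
  simp
  field_simp
  ring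

lemma ss_lt {a : ℝ} (h0 : 0 ≤ a) (h3 : a ≤ √3) : |ss a| < 1 := by
  have ha2 : a ^ 2 ≤ 3 := by nlinarith [sq3]
  have hp : 0 < 4 - a ^ 2 := by linarith
  have hr := rr_pos hp
  have h4 := rr_four hp
  have hs : 0 ≤ ss a := by unfold ss; positivity
  rw [abs_of_nonneg hs]
  by_contra! hc
  have h5 : 1 ≤ ss a ^ 4 := one_le_pow₀ hc
  have h6 : ss a ^ 4 * (4 - a ^ 2) = a ^ 4 / 16 := by
    unfold ss
    linear_combination a ^ 4 / 16 * h4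
  nlinarith [sq_nonneg a]

section system
variable (e : ℕ → ℝ)

/-- First component. -/
noncomputable def GG (a : ℝ) : ℝ := rr a * ps e (ss a)

/-- Second component. -/
noncomputable def HH (a : ℝ) : ℝ :=
  a / 2 * (rr a * ps e (ss a)) + (8 - a ^ 2) / 4 * (rr a ^ 2 * ps (dd e) (ss a))

/-- Third component. -/
noncomputable def KK (a : ℝ) : ℝ :=
  a ^ 2 / 8 * (rr a * ps e (ss a)) + a * (8 + a ^ 2) / 16 * (rr a ^ 2 * ps (dd e) (ss a))
    + (8 - a ^ 2) ^ 2 / 32 * (rr a ^ 3 * ps (dd (dd e)) (ss a))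

end system

lemma comp_deriv {e : ℕ → ℝ} (he : PB e) {a : ℝ} (h0 : 0 ≤ a) (h3 : a ≤ √3) (k : ℕ) :
    HasDerivAt (fun a => rr a ^ k * ps e (ss a))
      (k * a / (2 * (4 - a ^ 2)) * (rr a ^ k * ps e (ss a))
        + (8 - a ^ 2) / (4 * (4 - a ^ 2)) * (rr a ^ (k + 1) * ps (dd e) (ss a))) a := by
  have ha2 : a ^ 2 ≤ 3 := by nlinarith [sq3]
  have hp : 0 < 4 - a ^ 2 := by linarith
  have h1 := (ps_deriv he (ss_lt h0 h3)).comp a (ss_deriv hp)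
  have h2 := ((rr_deriv hp).pow k).mul h1
  convert! h2 using 1
  rcases k with _ | k
  · simp
    ring
  · simp [pow_succ]
    ring

lemma GG_deriv {e : ℕ → ℝ} (he : PB e) {a : ℝ} (h0 : 0 ≤ a) (h3 : a ≤ √3) :
    HasDerivAt (GG e) (HH e a / (4 - a ^ 2)) a := by
  have ha2 : a ^ 2 ≤ 3 := by nlinarith [sq3]
  have hp : 0 < 4 - a ^ 2 := by linarith
  have h := comp_deriv he h0 h3 1
  simp only [pow_one] at h
  convert! h using 1
  unfold HH
  field_simp
  push_cast
  ring

lemma HH_deriv {e : ℕ → ℝ} (he : PB e) {a : ℝ} (h0 : 0 ≤ a) (h3 : a ≤ √3) :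
    HasDerivAt (HH e) ((2 * KK e a + (4 - a ^ 2) / 2 * GG e a) / (4 - a ^ 2)) a := by
  have ha2 : a ^ 2 ≤ 3 := by nlinarith [sq3]
  have hp : 0 < 4 - a ^ 2 := by linarith
  have h1 := comp_deriv he h0 h3 1
  simp only [pow_one] at h1
  have h2 := comp_deriv (PB_dd he) h0 h3 2
  have p1 : HasDerivAt (fun a : ℝ => a / 2) (1 / 2) a := (hasDerivAt_id a).div_const 2
  have p2 : HasDerivAt (fun a : ℝ => (8 - a ^ 2) / 4) (-(2 * a) / 4) a := by
    simpa using ((hasDerivAt_pow 2 a).const_sub 8).div_const 4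
  convert! (p1.mul h1).add (p2.mul h2) using 1
  unfold KK GG
  generalize ps e (ss a) = Y0
  generalize ps (dd e) (ss a) = Y1
  generalize ps (dd (dd e)) (ss a) = Y2
  field_simp
  push_cast
  ring

lemma KK_deriv (c0 c1 c2 : ℝ) {a : ℝ} (h0 : 0 ≤ a) (h3 : a ≤ √3) :
    HasDerivAt (KK (ee c0 c1 c2)) (HH (ee c0 c1 c2) a / 4) a := by
  have ha2 : a ^ 2 ≤ 3 := by nlinarith [sq3]
  have hp : 0 < 4 - a ^ 2 := by linarith
  have he := ee_PB c0 c1 c2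
  have hode := ee_ode c0 c1 c2 (ss_lt h0 h3)
  generalize ee c0 c1 c2 = e at *
  have h1 := comp_deriv he h0 h3 1
  simp only [pow_one] at h1
  have h2 := comp_deriv (PB_dd he) h0 h3 2
  have h4 := comp_deriv (PB_dd (PB_dd he)) h0 h3 3
  have p1 : HasDerivAt (fun a : ℝ => a ^ 2 / 8) (2 * a / 8) a := by
    simpa using (hasDerivAt_pow 2 a).div_const 8
  have p2 : HasDerivAt (fun a : ℝ => a * (8 + a ^ 2) / 16) ((8 + 3 * a ^ 2) / 16) a := by
    convert! (((hasDerivAt_id a).mul ((hasDerivAt_pow 2 a).const_add 8))).div_const 16 using 1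
    simp
    ring
  have p3 : HasDerivAt (fun a : ℝ => (8 - a ^ 2) ^ 2 / 32) (-(4 * a * (8 - a ^ 2)) / 32) a := by
    convert! (((hasDerivAt_pow 2 a).const_sub 8).pow 2).div_const 32 using 1
    simp
    ring
  convert! ((p1.mul h1).add (p2.mul h2)).add (p3.mul h4) using 1
  unfold HH
  have hr := rr_four hp
  have hss : ss a = a * rr a / 2 := rfl
  generalize ps e (ss a) = Y0 at *
  generalize ps (dd e) (ss a) = Y1 at *
  generalize ps (dd (dd e)) (ss a) = Y2 at *
  generalize ps (dd (dd (dd e))) (ss a) = Y3 at *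
  rw [hss] at hode
  generalize rr a = r at *
  have hr' : r ^ 4 = 1 / (4 - a ^ 2) := by field_simp; linarith
  have h8 : 8 - a ^ 2 ≠ 0 := by nlinarith
  have hode' : (8 - a ^ 2) ^ 2 * Y3 = -16 * (4 - a ^ 2) *
      (6 * (a * r / 2) ^ 3 * Y2 + 7 * (a * r / 2) ^ 2 * Y1 + (a * r / 2) * Y0) := by
    have : 16 * (4 - a^2) * (1 + (a * r / 2) ^ 4) = (8 - a^2)^2 := by
      linear_combination a ^ 4 * hr
    rw [← this]
    linear_combination 16 * (4 - a^2) * hode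
  have hT : (8 - a ^ 2) ^ 2 * (r ^ 4 * Y3) = -16 *
      (6 * (a * r / 2) ^ 3 * Y2 + 7 * (a * r / 2) ^ 2 * Y1 + (a * r / 2) * Y0) := by
    linear_combination r ^ 4 * hode' - 16 *
      (6 * (a * r / 2) ^ 3 * Y2 + 7 * (a * r / 2) ^ 2 * Y1 + (a * r / 2) * Y0) * hr
  simp only [Nat.reduceAdd]
  generalize r ^ 4 * Y3 = Z at *
  push_cast
  field_simp
  linear_combination (-1024 * (8 - a ^ 2)) * hT

lemma gronwall3 {f g h : ℝ → ℝ} {b : ℝ} (hb : 0 ≤ b) (hb3 : b ≤ √3)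
    (hf : ∀ a, 0 ≤ a → a ≤ √3 → HasDerivAt f (g a / (4 - a ^ 2)) a)
    (hg : ∀ a, 0 ≤ a → a ≤ √3 → HasDerivAt g ((2 * h a + (4 - a ^ 2) / 2 * f a) / (4 - a ^ 2)) a)
    (hh : ∀ a, 0 ≤ a → a ≤ √3 → HasDerivAt h (g a / 4) a)
    (f0 : f 0 = 0) (g0 : g 0 = 0) (h0 : h 0 = 0) : f b = 0 ∧ g b = 0 := by
  set E : ℝ → ℝ := fun a => (f a ^ 2 + g a ^ 2 + h a ^ 2) * exp (-4 * a) with hE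
  have hd : ∀ a, 0 ≤ a → a ≤ √3 → ∃ d, HasDerivAt E d a ∧ d ≤ 0 := by
    intro a ha0 ha3
    have ha2 : a ^ 2 ≤ 3 := by nlinarith [sq3]
    have hp : 1 ≤ 4 - a ^ 2 := by linarith
    have he : HasDerivAt (fun a : ℝ => exp (-4 * a)) (exp (-4 * a) * (-4)) a := by
      simpa using ((hasDerivAt_id a).const_mul (-4)).exp
    refine ⟨_, ((((hf a ha0 ha3).pow 2).add ((hg a ha0 ha3).pow 2)).add
      ((hh a ha0 ha3).pow 2)).mul he, ?_⟩
    have hx := exp_pos (-4 * a)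
    simp only [Pi.add_apply, Pi.pow_apply]
    set F := f a
    set G := g a
    set H := h a
    set p := 4 - a ^ 2
    set i := p⁻¹ with hi
    have hi0 : 0 < i := by positivity
    have hi1 : i ≤ 1 := inv_le_one_of_one_le₀ hp
    have hpi : p * i = 1 := mul_inv_cancel₀ (by positivity)
    have key : 2 * F * (G * i) + 2 * G * (2 * H * i + F / 2) + 2 * H * (G / 4)
        - 4 * (F ^ 2 + G ^ 2 + H ^ 2) ≤ 0 := by
      have k1 : 2 * F * G * i ≤ F ^ 2 + G ^ 2 := by
        have : i * (2 * F * G) ≤ i * (F ^ 2 + G ^ 2) :=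
          mul_le_mul_of_nonneg_left (by nlinarith [sq_nonneg (F - G)]) hi0.le
        nlinarith [sq_nonneg F, sq_nonneg G]
      have k2 : 2 * G * H * i ≤ H ^ 2 + G ^ 2 := by
        have : i * (2 * G * H) ≤ i * (H ^ 2 + G ^ 2) :=
          mul_le_mul_of_nonneg_left (by nlinarith [sq_nonneg (H - G)]) hi0.le
        nlinarith [sq_nonneg H, sq_nonneg G]
      nlinarith [sq_nonneg (F - G), sq_nonneg (G - H), sq_nonneg F, sq_nonneg G, sq_nonneg H]
    have : (2 * H + p / 2 * F) / p = 2 * H * i + F / 2 := by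
      rw [div_eq_mul_inv, ← hi]; linear_combination F / 2 * hpi
    rw [this, div_eq_mul_inv, ← hi]
    have := mul_nonpos_of_nonneg_of_nonpos hx.le key
    refine le_trans (le_of_eq ?_) this
    push_cast
    ring
  have hanti : AntitoneOn E (Icc 0 (√3)) := by
    refine antitoneOn_of_deriv_nonpos (convex_Icc _ _) ?_ ?_ ?_
    · intro a ha
      obtain ⟨d, hd1, _⟩ := hd a ha.1 ha.2
      exact hd1.continuousAt.continuousWithinAt
    · intro a ha
      have ha' := interior_subset ha
      obtain ⟨d, hd1, _⟩ := hd a ha'.1 ha'.2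
      exact hd1.differentiableAt.differentiableWithinAt
    · intro a ha
      have ha' := interior_subset ha
      obtain ⟨d, hd1, hd2⟩ := hd a ha'.1 ha'.2
      rw [hd1.deriv]; exact hd2
  have h1 := hanti (left_mem_Icc.2 (sqrt_nonneg 3)) ⟨hb, hb3⟩ hb
  simp only [hE, f0, g0, h0] at h1
  have hx := exp_pos (-4 * b)
  have h2 : f b ^ 2 + g b ^ 2 + h b ^ 2 ≤ 0 := by
    by_contra! hc
    have := mul_pos hc hx
    simp only [ne_eq, OfNat.ofNat_ne_zero, not_false_eq_true, zero_pow, add_zero, zero_mul] at h1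
    linarith
  constructor <;> nlinarith [sq_nonneg (f b), sq_nonneg (g b), sq_nonneg (h b)]

/-- The function (4 - a^2) times the derivative of the moment of order one half. -/
noncomputable def vv (a : ℝ) : ℝ := -((4 - a ^ 2) / 2) * MM (3/2) a

lemma y_deriv {a : ℝ} (h0 : 0 ≤ a) (h3 : a ≤ √3) :
    HasDerivAt (MM (1/2)) (vv a / (4 - a ^ 2)) a := by
  have ha2 : a ^ 2 ≤ 3 := by nlinarith [sq3]
  have hp : 0 < 4 - a ^ 2 := by linarith
  convert! MM_deriv (a := a) (k := 1/2) (by linarith) (by norm_num) using 1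
  unfold vv
  norm_num
  field_simp

lemma v_deriv {a : ℝ} (h0 : 0 ≤ a) : HasDerivAt vv (MM (1/2) a / 4) a := by
  have h1 := MM_deriv (a := a) (k := 3/2) (by linarith) (by norm_num)
  have h2 : HasDerivAt (fun a : ℝ => -((4 - a ^ 2) / 2)) a a := by
    convert! (((hasDerivAt_pow 2 a).const_sub 4).div_const 2).neg using 1
    simp
    ring
  convert! h2.mul h1 using 1
  have := MM_ode (a := a) (by linarith)
  norm_num
  norm_num at this
  linear_combination -this

lemma main_eq {c0 c1 c2 : ℝ} (hc0 : c0 = √2 * MM (1/2) 0 ^ 2)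
    (hc1 : c1 = 2 * MM (1/2) 0 * vv 0) (hc2 : √2 * c2 = vv 0 ^ 2) :
    5 * (√3 / 2 * ps (dd (ee c0 c1 c2)) (√3 / 2)) + ps (ee c0 c1 c2) (√3 / 2) = -8 * π := by
  have s2 : √2 * √2 = 2 := mul_self_sqrt (by norm_num)
  have s20 : 0 < √2 := by positivity
  have hr0 : rr 0 * √2 = 1 := by
    unfold rr
    rw [show (4 - (0:ℝ) ^ 2) = 2 ^ (2:ℝ) by norm_num, ← rpow_mul (by norm_num), sqrt_eq_rpow,
      ← rpow_add (by norm_num)]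
    norm_num
  have hps : ∀ e : ℕ → ℝ, ps e 0 = e 0 := by
    intro e
    unfold ps
    rw [tsum_eq_single 0]
    · simp
    · intro m hm; simp [hm]
  have hs0 : ss 0 = 0 := by simp [ss]
  set y := MM (1/2) with hy
  set e := ee c0 c1 c2 with hee
  have he : PB e := ee_PB c0 c1 c2
  have key := gronwall3 (f := fun a => GG e a - y a ^ 2) (g := fun a => HH e a - 2 * y a * vv a)
    (h := fun a => KK e a - vv a ^ 2) (b := √3) (sqrt_nonneg 3) le_rfl ?_ ?_ ?_ ?_ ?_ ?_
  · obtain ⟨k1, k2⟩ := key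
    have hsq : (√3) ^ 2 = 3 := by rw [sq, sq3]
    have hr1 : rr (√3) = 1 := by unfold rr; rw [hsq]; norm_num
    have hs1 : ss (√3) = √3 / 2 := by unfold ss; rw [hr1]; ring
    simp only [GG, HH, hr1, hs1, vv, hsq] at k1 k2
    have fv := final_val
    rw [← hy] at fv
    norm_num at k1 k2 fv ⊢
    linear_combination 2 * √3 * k2 - 2 * k1 - 2 * fv - ps e (√3 / 2) * sq3
  · intro a h0 h3
    convert! (GG_deriv he h0 h3).sub ((y_deriv h0 h3).pow 2) using 1
    simp [hy]
    ring
  · intro a h0 h3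
    have ha2 : a ^ 2 ≤ 3 := by nlinarith [sq3]
    have hp : 0 < 4 - a ^ 2 := by linarith
    convert! (HH_deriv he h0 h3).sub (((y_deriv h0 h3).const_mul 2).mul (v_deriv h0)) using 1
    field_simp
    ring
  · intro a h0 h3
    convert! (KK_deriv c0 c1 c2 h0 h3).sub ((v_deriv h0).pow 2) using 1
    simp [hy, hee]
    ring
  · simp only [GG, hs0, hps, hee, ee]
    rw [hc0]
    linear_combination y 0 ^ 2 * hr0
  · simp only [HH, hs0, hps, hee, ee, dd]
    rw [hc1]
    norm_num
    have : rr 0 ^ 2 = 1 / 2 := by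
      have : (rr 0 * √2) ^ 2 = 1 := by rw [hr0]; norm_num
      rw [mul_pow, sq (√2), s2] at this
      linarith
    rw [this]
    ring
  · simp only [KK, hs0, hps, hee, ee, dd]
    rw [← hc2]
    norm_num
    have h2 : rr 0 ^ 2 = 1 / 2 := by
      have : (rr 0 * √2) ^ 2 = 1 := by rw [hr0]; norm_num
      rw [mul_pow, sq (√2), s2] at this
      linarith
    have h3 : rr 0 ^ 3 = √2 / 4 := by
      have : rr 0 = √2 / 2 := by linear_combination √2 / 2 * hr0 - rr 0 / 2 * s2
      rw [pow_succ, h2, this]; ring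
    rw [h3]
    ring

lemma pochR_succ (a : ℝ) (n : ℕ) : pochR a (n + 1) = pochR a n * (a + n) := by
  unfold pochR
  rw [Finset.prod_range_succ]

lemma pochR_pos {a : ℝ} (ha : 0 < a) (n : ℕ) : 0 < pochR a n := by
  unfold pochR
  exact Finset.prod_pos fun i _ => by positivity

lemma ee_mod0 (c0 c1 c2 : ℝ) (n : ℕ) : ee c0 c1 c2 (4 * n) =
    c0 * (pochR (1/4) n ^ 3 / (pochR 1 n * pochR (1/2) n * pochR (3/4) n)) * (-1) ^ n := by
  induction n with
  | zero => simp [ee, pochR]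
  | succ n ih =>
    have h1 := pochR_pos (show (0:ℝ) < 1/4 by norm_num) n
    have h2 := pochR_pos (show (0:ℝ) < 1 by norm_num) n
    have h3 := pochR_pos (show (0:ℝ) < 1/2 by norm_num) n
    have h4 := pochR_pos (show (0:ℝ) < 3/4 by norm_num) n
    have e1 : 4 * (n + 1) = 4 * n + 4 := by ring
    rw [e1, ee_succ, ih, pochR_succ, pochR_succ, pochR_succ, pochR_succ]
    push_cast
    rw [pow_succ (-1 : ℝ) n]
    generalize ((-1:ℝ)) ^ n = u
    field_simp
    ring

lemma ee_mod1 (c0 c1 c2 : ℝ) (n : ℕ) : ee c0 c1 c2 (4 * n + 1) =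
    c1 * (pochR (1/2) n ^ 3 / (pochR 1 n * pochR (3/4) n * pochR (5/4) n)) * (-1) ^ n := by
  induction n with
  | zero => simp [ee, pochR]
  | succ n ih =>
    have h1 := pochR_pos (show (0:ℝ) < 1/2 by norm_num) n
    have h2 := pochR_pos (show (0:ℝ) < 1 by norm_num) n
    have h3 := pochR_pos (show (0:ℝ) < 3/4 by norm_num) n
    have h4 := pochR_pos (show (0:ℝ) < 5/4 by norm_num) n
    have e1 : 4 * (n + 1) + 1 = (4 * n + 1) + 4 := by ring
    rw [e1, ee_succ, ih, pochR_succ, pochR_succ, pochR_succ, pochR_succ]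
    push_cast
    rw [pow_succ (-1 : ℝ) n]
    generalize ((-1:ℝ)) ^ n = u
    field_simp
    ring

lemma ee_mod2 (c0 c1 c2 : ℝ) (n : ℕ) : ee c0 c1 c2 (4 * n + 2) =
    c2 * (pochR (3/4) n ^ 3 / (pochR 1 n * pochR (3/2) n * pochR (5/4) n)) * (-1) ^ n := by
  induction n with
  | zero => simp [ee, pochR]
  | succ n ih =>
    have h1 := pochR_pos (show (0:ℝ) < 3/4 by norm_num) n
    have h2 := pochR_pos (show (0:ℝ) < 1 by norm_num) n
    have h3 := pochR_pos (show (0:ℝ) < 3/2 by norm_num) n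
    have h4 := pochR_pos (show (0:ℝ) < 5/4 by norm_num) n
    have e1 : 4 * (n + 1) + 2 = (4 * n + 2) + 4 := by ring
    rw [e1, ee_succ, ih, pochR_succ, pochR_succ, pochR_succ, pochR_succ]
    push_cast
    rw [pow_succ (-1 : ℝ) n]
    generalize ((-1:ℝ)) ^ n = u
    field_simp
    ring

lemma ee_mod3 (c0 c1 c2 : ℝ) (n : ℕ) : ee c0 c1 c2 (4 * n + 3) = 0 := by
  induction n with
  | zero => simp [ee]
  | succ n ih =>
    have e1 : 4 * (n + 1) + 3 = (4 * n + 3) + 4 := by ring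
    rw [e1, ee_succ, ih, mul_zero]

lemma s0_pow (n : ℕ) : (√3 / 2) ^ (4 * n) = ((3/4 : ℝ)) ^ (2 * n) := by
  have : (√3 / 2) ^ 2 = (3/4 : ℝ) := by rw [div_pow, sq, sq3]; norm_num
  rw [show 4 * n = 2 * (2 * n) by ring, pow_mul, this]

lemma s0_lt : |√3 / 2| < 1 := by
  rw [abs_of_nonneg (by positivity)]
  nlinarith [sq3, sqrt_nonneg 3]

/-- The combined series. -/
noncomputable def ff (c0 c1 c2 : ℝ) (m : ℕ) : ℝ :=
  5 * ((m:ℝ) * ee c0 c1 c2 m * (√3 / 2) ^ m) + ee c0 c1 c2 m * (√3 / 2) ^ m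

lemma ff_summable (c0 c1 c2 : ℝ) : Summable (ff c0 c1 c2) :=
  ((ps_summable (PB_theta (ee_PB c0 c1 c2)) s0_lt).mul_left 5).add
    (ps_summable (ee_PB c0 c1 c2) s0_lt)

lemma ff_tsum (c0 c1 c2 : ℝ) : ∑' m, ff c0 c1 c2 m =
    5 * (√3/2 * ps (dd (ee c0 c1 c2)) (√3/2)) + ps (ee c0 c1 c2) (√3/2) := by
  rw [theta1 (ee_PB c0 c1 c2) s0_lt]
  unfold ff ps
  rw [← tsum_mul_left]
  exact Summable.tsum_add ((ps_summable (PB_theta (ee_PB c0 c1 c2)) s0_lt).mul_left 5)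
    (ps_summable (ee_PB c0 c1 c2) s0_lt)

lemma ff0 (c0 c1 c2 : ℝ) (n : ℕ) : ff c0 c1 c2 (4 * n) = c0 * term2 n := by
  unfold ff term2
  rw [ee_mod0, s0_pow]
  push_cast
  ring

lemma ff1 (c0 c1 c2 : ℝ) (n : ℕ) : ff c0 c1 c2 (4 * n + 1) = c1 * √3 * term1 n := by
  unfold ff term1
  rw [ee_mod1, pow_succ (√3 / 2), s0_pow]
  push_cast
  ring

lemma ff2 (c0 c1 c2 : ℝ) (n : ℕ) : ff c0 c1 c2 (4 * n + 2) = c2 * (3 / 4) * term3 n := by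
  have : (√3 / 2) ^ 2 = (3/4 : ℝ) := by rw [div_pow, sq, sq3]; norm_num
  unfold ff term3
  rw [ee_mod2, pow_add, s0_pow, this]
  push_cast
  ring

lemma ff3 (c0 c1 c2 : ℝ) (n : ℕ) : ff c0 c1 c2 (4 * n + 3) = 0 := by
  unfold ff
  rw [ee_mod3]
  ring

lemma term2_summable : Summable term2 := by
  have h := (ff_summable 1 1 1).comp_injective (i := fun n : ℕ => 4 * n)
    (fun a b h => by simp only at h; omega)
  refine h.congr fun n => ?_
  simp [ff0]

lemma term1_summable : Summable term1 := by
  have h := (ff_summable 1 1 1).comp_injective (i := fun n : ℕ => 4 * n + 1)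
    (fun a b h => by simp only at h; omega)
  refine (h.mul_left (1 / √3)).congr fun n => ?_
  have : √3 ≠ 0 := by positivity
  simp only [Function.comp, ff1]
  field_simp

lemma term3_summable : Summable term3 := by
  have h := (ff_summable 1 1 1).comp_injective (i := fun n : ℕ => 4 * n + 2)
    (fun a b h => by simp only at h; omega)
  refine (h.mul_left (4 / 3)).congr fun n => ?_
  simp only [Function.comp, ff2]
  ring

lemma ff_split (c0 c1 c2 : ℝ) : ∑' m, ff c0 c1 c2 m =
    c0 * (∑' n, term2 n) + c1 * √3 * (∑' n, term1 n) + c2 * (3 / 4) * (∑' n, term3 n) := by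
  have hf := ff_summable c0 c1 c2
  have he : Summable (fun k => ff c0 c1 c2 (2 * k)) :=
    hf.comp_injective (i := fun n : ℕ => 2 * n) (fun a b h => by simp only at h; omega)
  have ho : Summable (fun k => ff c0 c1 c2 (2 * k + 1)) :=
    hf.comp_injective (i := fun n : ℕ => 2 * n + 1) (fun a b h => by simp only at h; omega)
  have i0 : ∀ k, ff c0 c1 c2 (2 * (2 * k)) = c0 * term2 k := fun k => by
    rw [← ff0 c0 c1 c2]; congr 1; ring
  have i1 : ∀ k, ff c0 c1 c2 (2 * (2 * k) + 1) = c1 * √3 * term1 k := fun k => by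
    rw [← ff1 c0 c1 c2]; congr 1; ring
  have i2 : ∀ k, ff c0 c1 c2 (2 * (2 * k + 1)) = c2 * (3 / 4) * term3 k := fun k => by
    rw [← ff2 c0 c1 c2]; congr 1; ring
  have i3 : ∀ k, ff c0 c1 c2 (2 * (2 * k + 1) + 1) = 0 := fun k => by
    rw [← ff3 c0 c1 c2 k]; congr 1; ring
  rw [← tsum_even_add_odd he ho]
  rw [← tsum_even_add_odd (f := fun k => ff c0 c1 c2 (2 * k)),
    ← tsum_even_add_odd (f := fun k => ff c0 c1 c2 (2 * k + 1))]
  · simp only [i0, i1, i2, i3, tsum_mul_left, tsum_zero]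
    ring
  · simp only [i1]; exact term1_summable.mul_left _
  · simp only [i3]; exact summable_zero
  · simp only [i0]; exact term2_summable.mul_left _
  · simp only [i2]; exact term3_summable.mul_left _

lemma gamma_prod : Real.Gamma (1/4) * Real.Gamma (3/4) = π * √2 := by
  have h := Real.Gamma_mul_Gamma_one_sub (1/4)
  rw [show (1:ℝ) - 1/4 = 3/4 by norm_num, show π * (1/4) = π / 4 by ring, sin_pi_div_four] at h
  rw [h]
  have : √2 * √2 = 2 := mul_self_sqrt (by norm_num)
  have h0 : √2 ≠ 0 := by positivity
  field_simp
  linear_combination -this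

lemma MM_half : 2 * MM (1/2) 0 * √π = Real.Gamma (1/4) ^ 2 := by
  have h := MM_zero (c := 1/4) (by norm_num)
  norm_num at h
  have h1 : Real.Gamma (1/2) = √π := Real.Gamma_one_half_eq
  have hp : √π ≠ 0 := by have := pi_pos; positivity
  norm_num at h1
  rw [h1] at h
  norm_num
  rw [h]
  field_simp

lemma MM_three_half : MM (3/2) 0 * √π = Real.Gamma (3/4) ^ 2 := by
  have h := MM_zero (c := 3/4) (by norm_num)
  norm_num at h
  have h1 : Real.Gamma (1/2) = √π := Real.Gamma_one_half_eq
  have h2 : Real.Gamma (3/2) = √π / 2 := by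
    have := Real.Gamma_add_one (s := 1/2) (by norm_num)
    rw [h1] at this
    norm_num at this
    rw [this]; ring
  have hp : √π ≠ 0 := by have := pi_pos; positivity
  rw [h2] at h
  field_simp at h
  linear_combination h

theorem three_series_identity :
    Summable term1 ∧ Summable term2 ∧ Summable term3 ∧
    (Real.sqrt 3 / 2) * (∑' n : ℕ, term1 n)
      - (Real.sqrt 2 * π^2 / (8 * (Real.Gamma (3/4))^4)) * (∑' n : ℕ, term2 n)
      - (3 * Real.sqrt 2 * (Real.Gamma (3/4))^4 / (16 * π^2)) * (∑' n : ℕ, term3 n) = 1 := by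
  refine ⟨term1_summable, term2_summable, term3_summable, ?_⟩
  have s2 : √2 ^ 2 = 2 := Real.sq_sqrt (by norm_num)
  have s2p : (0:ℝ) < √2 := by positivity
  have hpi := pi_pos
  have sp : √π ^ 2 = π := Real.sq_sqrt hpi.le
  have spp : 0 < √π := by positivity
  have hg : 0 < Real.Gamma (3/4) := Real.Gamma_pos_of_pos (by norm_num)
  have gp := gamma_prod
  have m1 := MM_half
  have m2 := MM_three_half
  have hv : vv 0 = -2 * MM (3/2) 0 := by unfold vv; norm_num
  set g := Real.Gamma (3/4) with hgdef
  set w := Real.Gamma (1/4) with hwdef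
  have w2 : w ^ 2 * g ^ 2 = 2 * π ^ 2 := by
    rw [← mul_pow, gp, mul_pow, s2]; ring
  have hM1 : MM (1/2) 0 = √π ^ 3 / g ^ 2 := by
    rw [eq_div_iff (by positivity)]
    have : 2 * √π * (MM (1/2) 0 * g ^ 2) = 2 * √π * √π ^ 3 := by
      linear_combination g ^ 2 * m1 + w2 - 2 * (√π ^ 2 + π) * sp
    exact mul_left_cancel₀ (by positivity) this
  have hM3 : MM (3/2) 0 = g ^ 2 / √π := by
    rw [eq_div_iff (by positivity)]; exact m2
  have key := main_eq (c0 := √2 * MM (1/2) 0 ^ 2) (c1 := 2 * MM (1/2) 0 * vv 0)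
    (c2 := 2 * √2 * g ^ 4 / π) rfl rfl (by
      rw [hv, hM3, mul_pow, div_pow, sp]
      field_simp
      linear_combination s2)
  rw [← ff_tsum, ff_split] at key
  have k0 : √2 * MM (1/2) 0 ^ 2 = √2 * π ^ 3 / g ^ 4 := by
    rw [hM1, div_pow, show (√π ^ 3) ^ 2 = (√π ^ 2) ^ 3 by ring, sp]
    field_simp
  have k1 : 2 * MM (1/2) 0 * vv 0 = -4 * π := by
    rw [hv, hM1, hM3]
    have : √π ^ 3 = √π * π := by rw [pow_succ, sp]; ring
    rw [this]
    field_simp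
    norm_num
  rw [k0, k1] at key
  generalize (∑' n : ℕ, term1 n) = S1 at *
  generalize (∑' n : ℕ, term2 n) = S2 at *
  generalize (∑' n : ℕ, term3 n) = S3 at *
  field_simp at key ⊢
  linear_combination (-8) * key
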